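/- In the Example-1 economy, the matching m* that matches a1–b1 and a2–b2 in period 1 and a3–b3 and a4–b4 in period 2 is a rational expectations solution of E^2. -/

import Mathlib

/-!
A framework for two-sided, one-to-one, irreversible dynamic matching markets
with conjectures, following Doval's "A framework for (dynamic) stability".

Periods are indexed `0, …, T-1` (the paper's periods `1, …, T`).
-/

namespace DynMatch

open Classical

noncomputable section

/-- A length-`T` two-sided dynamic economy: the arrivals on each side in each period. -/
structure Economy (A B : Type) where
  T : ℕ
  arrA : ℕ → Finset A
  arrB : ℕ → Finset B

/-- Validity of an economy: positive length, pairwise disjoint arrivals, and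
no arrivals outside the horizon. -/
def Economy.Valid {A B : Type} (E : Economy A B) : Prop :=
  0 < E.T ∧
  (∀ s t, s ≠ t → Disjoint (E.arrA s) (E.arrA t)) ∧
  (∀ s t, s ≠ t → Disjoint (E.arrB s) (E.arrB t)) ∧
  (∀ s, E.T ≤ s → E.arrA s = ∅) ∧ (∀ s, E.T ≤ s → E.arrB s = ∅)

/-- A raw dynamic matching: in every period, a partial pairing between the two sides
(`none` means unmatched, i.e. matched to oneself). -/
structure PreMatching (A B : Type) where
  mA : ℕ → A → Option B
  mB : ℕ → B → Option A

variable {A B : Type} [DecidableEq A] [DecidableEq B]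

/-- Side-`A` agents having arrived up to (and including) period `t`. -/
def arrAUpTo (E : Economy A B) (t : ℕ) : Finset A := (Finset.range (t+1)).biUnion E.arrA

/-- Side-`B` agents having arrived up to (and including) period `t`. -/
def arrBUpTo (E : Economy A B) (t : ℕ) : Finset B := (Finset.range (t+1)).biUnion E.arrB

/-- `m` is an irreversible dynamic matching for the economy `E`: in every period it is
an involutive pairing between arrived agents of the two sides, and once matched a
pair stays matched. -/
def IsMatching (E : Economy A B) (m : PreMatching A B) : Prop :=
  (∀ t a b, t < E.T → (m.mA t a = some b ↔ m.mB t b = some a)) ∧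
  (∀ t a, t < E.T → m.mA t a ≠ none → a ∈ arrAUpTo E t) ∧
  (∀ t a b, t < E.T → m.mA t a = some b → b ∈ arrBUpTo E t) ∧
  (∀ t s a, t ≤ s → s < E.T → m.mA t a ≠ none → m.mA s a = m.mA t a) ∧
  (∀ t s b, t ≤ s → s < E.T → m.mB t b ≠ none → m.mB s b = m.mB t b)

/-- The everywhere-unmatched prematching. -/
def emptyM : PreMatching A B := ⟨fun _ _ => none, fun _ _ => none⟩

/-- An agent of the economy: a side-`A` or a side-`B` agent. -/
abbrev Agent (A B : Type) := A ⊕ B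

/-- `𝒜_t(m^{t-1})`: side-`A` agents available to match in period `t` given history `m`. -/
def availA (E : Economy A B) (m : PreMatching A B) (t : ℕ) : Finset A :=
  (arrAUpTo E t).filter fun a => ∀ s, s < t → m.mA s a = none

/-- `ℬ_t(m^{t-1})`: side-`B` agents available to match in period `t` given history `m`. -/
def availB (E : Economy A B) (m : PreMatching A B) (t : ℕ) : Finset B :=
  (arrBUpTo E t).filter fun b => ∀ s, s < t → m.mB s b = none

/-- `k ∈ 𝒜_t(m^{t-1}) ∪ ℬ_t(m^{t-1})`. -/
def isAvail (E : Economy A B) (m : PreMatching A B) (t : ℕ) : Agent A B → Prop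
  | Sum.inl a => a ∈ availA E m t
  | Sum.inr b => b ∈ availB E m t

/-- `k ∈ A_1 ∪ B_1`: `k` is a first-period arrival. -/
def inPeriodOne (E : Economy A B) : Agent A B → Prop
  | Sum.inl a => a ∈ E.arrA 0
  | Sum.inr b => b ∈ E.arrB 0

/-- `m_t(k) = k`: agent `k` is unmatched in period `t` under `m`. -/
def unmatchedAt (m : PreMatching A B) (t : ℕ) : Agent A B → Prop
  | Sum.inl a => m.mA t a = none
  | Sum.inr b => m.mB t b = none

/-- `m` and `m'` agree in all periods `s < t` (i.e. they share the history `m^{t-1}`). -/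
def agreeUpTo (m m' : PreMatching A B) (t : ℕ) : Prop :=
  ∀ s, s < t → (∀ a, m.mA s a = m'.mA s a) ∧ (∀ b, m.mB s b = m'.mB s b)

/-- Agent `k` is unmatched through period `t` (all periods `s ≤ t`) under `m`. -/
def unmatchedThrough (m : PreMatching A B) (t : ℕ) : Agent A B → Prop
  | Sum.inl a => ∀ s, s ≤ t → m.mA s a = none
  | Sum.inr b => ∀ s, s ≤ t → m.mB s b = none

/-- `M_T(m^{t-1})`: matchings of `E` agreeing with `m` through period `t-1`. -/
def MSetH (E : Economy A B) (m : PreMatching A B) (t : ℕ) : Set (PreMatching A B) :=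
  {m' | IsMatching E m' ∧ agreeUpTo m m' t}

/-- `M_T(m^{t-1}, k)`: matchings of `E` agreeing with `m` through period `t-1` and
leaving `k` unmatched through period `t`. -/
def MSet (E : Economy A B) (m : PreMatching A B) (t : ℕ) (k : Agent A B) :
    Set (PreMatching A B) :=
  {m' | IsMatching E m' ∧ agreeUpTo m m' t ∧ unmatchedThrough m' t k}

/-- Preferences: Bernoulli utilities on both sides and discount factors.
(The payoff of remaining single is normalized to `0`.) -/
structure Pref (A B : Type) where
  u : A → B → ℝ
  v : A → B → ℝ
  dA : A → ℝ
  dB : B → ℝ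

/-- Discount factors lie in `[0,1]`. -/
def Pref.Valid (P : Pref A B) : Prop :=
  (∀ a, 0 ≤ P.dA a ∧ P.dA a ≤ 1) ∧ (∀ b, 0 ≤ P.dB b ∧ P.dB b ≤ 1)

/-- `t_m(a)`: the first period `s ≥ t` at which `a` is matched under `m` (`T` if never). -/
def matchTimeA (E : Economy A B) (m : PreMatching A B) (t : ℕ) (a : A) : ℕ :=
  min (sInf {s | t ≤ s ∧ m.mA s a ≠ none}) E.T

/-- `t_m(b)`: the first period `s ≥ t` at which `b` is matched under `m` (`T` if never). -/
def matchTimeB (E : Economy A B) (m : PreMatching A B) (t : ℕ) (b : B) : ℕ :=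
  min (sInf {s | t ≤ s ∧ m.mB s b ≠ none}) E.T

/-- `U_t(a,m) = δ_a^{t_m(a)-t}·u(a, m_T(a))` (and `0` if `a` ends up unmatched). -/
def Upay (P : Pref A B) (E : Economy A B) (m : PreMatching A B) (t : ℕ) (a : A) : ℝ :=
  match m.mA (E.T - 1) a with
  | none => 0
  | some b => P.dA a ^ (matchTimeA E m t a - t) * P.u a b

/-- `V_t(b,m) = δ_b^{t_m(b)-t}·v(m_T(b), b)` (and `0` if `b` ends up unmatched). -/
def Vpay (P : Pref A B) (E : Economy A B) (m : PreMatching A B) (t : ℕ) (b : B) : ℝ :=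
  match m.mB (E.T - 1) b with
  | none => 0
  | some a => P.dB b ^ (matchTimeB E m t b - t) * P.v a b

/-- A family of conjectures `Φ`: for every period `t`, history `m^{t-1}` and agent `k`,
a set `φ_t(m^{t-1},k)` of matchings `k` considers possible upon remaining unmatched. -/
abbrev ConjFam (A B : Type) := ℕ → PreMatching A B → Agent A B → Set (PreMatching A B)

/-- Validity of a family of conjectures for `E`: conjectures are (nonempty) subsets of
`M_T(m^{t-1},k)` and depend on the matching only through the history `m^{t-1}`. -/
def ConjFam.Valid (E : Economy A B) (φ : ConjFam A B) : Prop :=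
  (∀ t m k, φ t m k ⊆ MSet E m t k) ∧
  (∀ t m m' k, agreeUpTo m m' t → φ t m k = φ t m' k) ∧
  (∀ t m k, t < E.T → IsMatching E m → isAvail E m t k → (φ t m k).Nonempty)

/-- `m` is a `Φ`-solution for `E` (Definition 3): in every period, every available agent
weakly prefers `m` to some conjectured matching, and no available pair blocks. -/
def IsSolution (P : Pref A B) (E : Economy A B) (φ : ConjFam A B)
    (m : PreMatching A B) : Prop :=
  IsMatching E m ∧
  ∀ t, t < E.T →
    ((∀ a ∈ availA E m t, ∃ m' ∈ φ t m (Sum.inl a), Upay P E m' t a ≤ Upay P E m t a) ∧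
     (∀ b ∈ availB E m t, ∃ m' ∈ φ t m (Sum.inr b), Vpay P E m' t b ≤ Vpay P E m t b) ∧
     (∀ a ∈ availA E m t, ∀ b ∈ availB E m t,
        ¬(P.u a b > Upay P E m t a ∧ P.v a b > Vpay P E m t b)))

/-- `Σ^Φ_T(E)`: the set of `Φ`-solutions of `E`. -/
def SolSet (P : Pref A B) (E : Economy A B) (φ : ConjFam A B) : Set (PreMatching A B) :=
  {m | IsSolution P E φ m}

/-- The static (Gale–Shapley) notion of stability, for length-1 economies:
individual rationality plus absence of blocking pairs. -/
def Stable1 (P : Pref A B) (E : Economy A B) (m : PreMatching A B) : Prop :=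
  IsMatching E m ∧
  (∀ a b, m.mA (E.T - 1) a = some b → 0 ≤ P.u a b) ∧
  (∀ b a, m.mB (E.T - 1) b = some a → 0 ≤ P.v a b) ∧
  (∀ a ∈ E.arrA 0, ∀ b ∈ E.arrB 0,
     ¬(P.u a b > Upay P E m 0 a ∧ P.v a b > Vpay P E m 0 b))

/-- The worst (minimal) period-`t` payoff of `a` over the set `C (inl a)` of matchings. -/
def wA (P : Pref A B) (E : Economy A B) (t : ℕ)
    (C : Agent A B → Set (PreMatching A B)) (a : A) : ℝ :=
  sInf ((fun m' => Upay P E m' t a) '' C (Sum.inl a))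

/-- The worst (minimal) period-`t` payoff of `b` over the set `C (inr b)` of matchings. -/
def wB (P : Pref A B) (E : Economy A B) (t : ℕ)
    (C : Agent A B → Set (PreMatching A B)) (b : B) : ℝ :=
  sInf ((fun m' => Vpay P E m' t b) '' C (Sum.inr b))

/-- Utility of side-`A` agent `a` in the induced one-period economy with outside
option value `W a` (truncated preferences). -/
def indU (P : Pref A B) (W : A → ℝ) (a : A) : Option B → ℝ
  | none => W a
  | some b => P.u a b

/-- Utility of side-`B` agent `b` in the induced one-period economy with outside
option value `W b` (truncated preferences). -/
def indV (P : Pref A B) (W : B → ℝ) (b : B) : Option A → ℝ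
  | none => W b
  | some a => P.v a b

/-- The period-`t` component of `mbar` is a stable matching of the one-period economy
`E_{t,φ}(m^{t-1})` induced by the conjecture profile `C` (Definition 6): matching among
the available agents, individually rational w.r.t. the worst-conjecture thresholds,
and without blocking pairs in the truncated preferences. -/
def StableInduced (P : Pref A B) (E : Economy A B) (m : PreMatching A B) (t : ℕ)
    (C : Agent A B → Set (PreMatching A B)) (mbar : PreMatching A B) : Prop :=
  (∀ a ∈ availA E m t, ∀ b, mbar.mA t a = some b → b ∈ availB E m t ∧ mbar.mB t b = some a) ∧
  (∀ b ∈ availB E m t, ∀ a, mbar.mB t b = some a → a ∈ availA E m t ∧ mbar.mA t a = some b) ∧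
  (∀ a ∈ availA E m t, ∀ b, mbar.mA t a = some b → wA P E t C a ≤ P.u a b) ∧
  (∀ b ∈ availB E m t, ∀ a, mbar.mB t b = some a → wB P E t C b ≤ P.v a b) ∧
  (∀ a ∈ availA E m t, ∀ b ∈ availB E m t,
     ¬(P.u a b > indU P (wA P E t C) a (mbar.mA t a) ∧
       P.v a b > indV P (wB P E t C) b (mbar.mB t b)))

/-- `mbar_t` is stable among those who match in period `t` relative to the conjecture
profile `C` (Definition 7): every available agent matched in period `t` weakly prefers
its partner to its worst conjectured matching, and no pair of agents both matched in
period `t` blocks. -/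
def StableAmongMatched (P : Pref A B) (E : Economy A B) (m : PreMatching A B) (t : ℕ)
    (C : Agent A B → Set (PreMatching A B)) (mbar : PreMatching A B) : Prop :=
  (∀ a ∈ availA E m t, ∀ b, mbar.mA t a = some b → wA P E t C a ≤ P.u a b) ∧
  (∀ b ∈ availB E m t, ∀ a, mbar.mB t b = some a → wB P E t C b ≤ P.v a b) ∧
  (∀ a ∈ availA E m t, ∀ b ∈ availB E m t, ∀ b' a',
     mbar.mA t a = some b' → mbar.mB t b = some a' →
     ¬(P.u a b > P.u a b' ∧ P.v a b > P.v a' b))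

/-- `E_t^T(m^{t-1})`: the continuation economy starting at period `t` given history `m`:
its first-period arrivals are the agents available at `t`, later arrivals are unchanged. -/
def contEconomy (E : Economy A B) (m : PreMatching A B) (t : ℕ) : Economy A B where
  T := E.T - t
  arrA := fun s => if s = 0 then availA E m t else E.arrA (t + s)
  arrB := fun s => if s = 0 then availB E m t else E.arrB (t + s)

/-- The restriction of `m` to the continuation economy starting in period `t`:
time is shifted by `t` and agents matched strictly before `t` are dropped. -/
def restrictM (m : PreMatching A B) (t : ℕ) : PreMatching A B where
  mA := fun s a => if ∀ s', s' < t → m.mA s' a = none then m.mA (t + s) a else none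
  mB := fun s b => if ∀ s', s' < t → m.mB s' b = none then m.mB (t + s) b else none

/-- The matching of the original economy corresponding to history `m` through period
`t-1` followed by the continuation matching `m'` (indexed from `0`) of the
continuation economy. -/
def splice (m m' : PreMatching A B) (t : ℕ) : PreMatching A B where
  mA := fun s a => if s < t then m.mA s a
    else if ∀ s', s' < t → m.mA s' a = none then m'.mA (s - t) a
    else m.mA (t - 1) a
  mB := fun s b => if s < t then m.mB s b
    else if ∀ s', s' < t → m.mB s' b = none then m'.mB (s - t) b
    else m.mB (t - 1) b

/-- The family of conjectures that the family `φ` of the original economy induces on the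
continuation economy `E_t^T(m^{t-1})`: at a continuation history, it is the (restriction
of the) original conjectures at the corresponding original history. -/
def contConj (E : Economy A B) (φ : ConjFam A B) (m : PreMatching A B) (t : ℕ) :
    ConjFam A B :=
  fun s mbar k => (fun m' => restrictM m' t) '' φ (t + s) (splice m mbar t) k

/-- The conjectures of eq. (2): the agent only rules out continuation matchings that do
not conform with the solution concept `S` from tomorrow onward. -/
def starConj (S : Economy A B → Set (PreMatching A B)) (E : Economy A B) : ConjFam A B :=
  fun t m k =>
    {m' | m' ∈ MSet E m t k ∧ restrictM m' (t+1) ∈ S (contEconomy E m' (t+1))}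

/-- `S` is the solution correspondence `Σ*` recursively generated by the conjectures of
eq. (2): stability for one-period economies, `Φ*`-solutions for longer economies
(empty continuations impose no restriction). -/
def IsStarFamily (P : Pref A B) (S : Economy A B → Set (PreMatching A B)) : Prop :=
  (∀ E : Economy A B, E.T = 0 → S E = Set.univ) ∧
  (∀ E : Economy A B, E.T = 1 → S E = {m | Stable1 P E m}) ∧
  (∀ E : Economy A B, 2 ≤ E.T → S E = SolSet P E (starConj S E))

/-- The decreasing recursion defining the CVR conjectures at period `t`, history `m`,
relative to the continuation solution correspondence `DS`. -/
def cvrIter (P : Pref A B) (E : Economy A B)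
    (DS : Economy A B → Set (PreMatching A B)) (t : ℕ) (m : PreMatching A B) :
    ℕ → Agent A B → Set (PreMatching A B)
  | 0 => fun k => MSet E m t k
  | n+1 => fun k =>
      {mbar | mbar ∈ MSet E m t k ∧
        StableAmongMatched P E m t (cvrIter P E DS t m n) mbar ∧
        restrictM mbar (t+1) ∈ DS (contEconomy E mbar (t+1))}

/-- The CVR conjectures `φ_{D̂S,t}(m^{t-1},·)`: the limit (intersection) of the
decreasing recursion `cvrIter`. -/
def cvrConj (P : Pref A B) (DS : Economy A B → Set (PreMatching A B))
    (E : Economy A B) : ConjFam A B :=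
  fun t m k => ⋂ n, cvrIter P E DS t m n k

/-- `DS` is the CVR-dynamic-stability correspondence `D̂S`: stable matchings for
one-period economies, `Φ_{D̂S}`-solutions for longer economies. -/
def IsCVRFamily (P : Pref A B) (DS : Economy A B → Set (PreMatching A B)) : Prop :=
  (∀ E : Economy A B, E.T = 0 → DS E = Set.univ) ∧
  (∀ E : Economy A B, E.T = 1 → DS E = {m | Stable1 P E m}) ∧
  (∀ E : Economy A B, 2 ≤ E.T → DS E = SolSet P E (cvrConj P DS E))

/-- The dynamic-stability conjectures of Doval (2022): the period-`t` matching is stable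
among those who match relative to individually rational continuation values, and the
continuation is dynamically stable. -/
def dsConj (P : Pref A B) (DSol : Economy A B → Set (PreMatching A B))
    (E : Economy A B) : ConjFam A B :=
  fun t m k =>
    {mbar | mbar ∈ MSet E m t k ∧
      (∀ a ∈ availA E m t, ∀ b, mbar.mA t a = some b → 0 ≤ P.u a b) ∧
      (∀ b ∈ availB E m t, ∀ a, mbar.mB t b = some a → 0 ≤ P.v a b) ∧
      (∀ a ∈ availA E m t, ∀ b ∈ availB E m t, ∀ b' a',
         mbar.mA t a = some b' → mbar.mB t b = some a' →
         ¬(P.u a b > P.u a b' ∧ P.v a b > P.v a' b)) ∧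
      restrictM mbar (t+1) ∈ DSol (contEconomy E mbar (t+1))}

/-- `DSol` is the dynamic-stability correspondence `DS` of Doval (2022). -/
def IsDSFamily (P : Pref A B) (DSol : Economy A B → Set (PreMatching A B)) : Prop :=
  (∀ E : Economy A B, E.T = 0 → DSol E = Set.univ) ∧
  (∀ E : Economy A B, E.T = 1 → DSol E = {m | Stable1 P E m}) ∧
  (∀ E : Economy A B, 2 ≤ E.T → DSol E = SolSet P E (dsConj P DSol E))

/-- `E_{\k}`: the economy identical to `E` except that agent `k`'s arrival is delayed
by one period (from period `0` to period `1`). -/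
def delayEconomy (E : Economy A B) : Agent A B → Economy A B
  | Sum.inl a =>
      { T := E.T
        arrA := fun s => if s = 0 then E.arrA 0 \ {a}
                 else if s = 1 then insert a (E.arrA 1) else E.arrA s
        arrB := E.arrB }
  | Sum.inr b =>
      { T := E.T
        arrA := E.arrA
        arrB := fun s => if s = 0 then E.arrB 0 \ {b}
                 else if s = 1 then insert b (E.arrB 1) else E.arrB s }

/-- The candidate set `M*(m^{t-1}, C, Scont)`: matchings whose period-`t` matching is
stable in the one-period economy induced by the continuation-value sets `C`, and whose
continuation lies in `Scont` of the induced continuation economy. -/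
def candT (P : Pref A B) (Scont : Economy A B → Set (PreMatching A B))
    (E : Economy A B) (t : ℕ) (m : PreMatching A B)
    (C : Agent A B → Set (PreMatching A B)) : Set (PreMatching A B) :=
  {mbar | mbar ∈ MSetH E m t ∧ StableInduced P E m t C mbar ∧
    restrictM mbar (t+1) ∈ Scont (contEconomy E mbar (t+1))}

/-- The increasing recursion `F_n` defining the sophisticated-dynamic-stability
conjectures at period `t`, history `m`, relative to the correspondence `SDS` on
strictly shorter problems. -/
def sdsF (P : Pref A B) (SDS : Economy A B → Set (PreMatching A B))
    (E : Economy A B) (t : ℕ) (m : PreMatching A B) :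
    ℕ → Agent A B → Set (PreMatching A B)
  | 0 => fun k =>
      {mbar | mbar ∈ MSet E m t k ∧
        restrictM mbar t ∈ SDS (delayEconomy (contEconomy E m t) k)}
  | n+1 => fun k => sdsF P SDS E t m n k ∪
      {mbar | mbar ∈ candT P SDS E t m (sdsF P SDS E t m n) ∧ unmatchedAt mbar t k}

/-- The SDS conjectures `φ_{SDS,t}`: the limit (union) of the increasing recursion `F_n`. -/
def sdsConj (P : Pref A B) (SDS : Economy A B → Set (PreMatching A B))
    (E : Economy A B) : ConjFam A B :=
  fun t m k => ⋃ n, sdsF P SDS E t m n k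

/-- `SDS` is the sophisticated-dynamic-stability correspondence. -/
def IsSDSFamily (P : Pref A B) (SDS : Economy A B → Set (PreMatching A B)) : Prop :=
  (∀ E : Economy A B, E.T = 0 → SDS E = Set.univ) ∧
  (∀ E : Economy A B, E.T = 1 → SDS E = {m | Stable1 P E m}) ∧
  (∀ E : Economy A B, 2 ≤ E.T → SDS E = SolSet P E (sdsConj P SDS E))

/-- The rational-expectations conjectures: `k` conjectures exactly the `RE` solutions of
the continuation economy in which `k`'s arrival is delayed by one period. -/
def reConj (RE : Economy A B → Set (PreMatching A B)) (E : Economy A B) : ConjFam A B :=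
  fun t m k =>
    {mbar | mbar ∈ MSet E m t k ∧
      restrictM mbar t ∈ RE (delayEconomy (contEconomy E m t) k)}

/-- `RE` is the rational-expectations solution correspondence. -/
def IsREFamily (P : Pref A B) (RE : Economy A B → Set (PreMatching A B)) : Prop :=
  (∀ E : Economy A B, E.T = 1 → RE E = {m | Stable1 P E m}) ∧
  (∀ E : Economy A B, 2 ≤ E.T → RE E = SolSet P E (reConj RE E))


/-! ### The Example-1 economy.
Side-`A` agents `a1,…,a4` are `0,…,3 : Fin 4`; side-`B` agents `b1,…,b4` are
`0,…,3 : Fin 4`. Arrivals: `A_1 = {a1,a2,a3}`, `B_1 = {b1,b2}`, `A_2 = {a4}`,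
`B_2 = {b3,b4}`. -/

/-- The Example-1 economy. -/
def E1 : Economy (Fin 4) (Fin 4) where
  T := 2
  arrA := fun s => if s = 0 then {0, 1, 2} else if s = 1 then {3} else ∅
  arrB := fun s => if s = 0 then {0, 1} else if s = 1 then {2, 3} else ∅

/-- `P` realizes the strict rankings of discounted payoffs of Example 1
(unlisted partners are unacceptable, i.e. have negative utility; `a2` and `b1`
have discount factors below but close enough to `1` that a better static partner is
preferred regardless of timing). -/
def Ex1Pref (P : Pref (Fin 4) (Fin 4)) : Prop :=
  P.Valid ∧
  -- a1: (b4,0) ≻ (b2,0) ≻ (b1,0) ≻ (b4,1) ≻ all else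
  (P.u 0 3 > P.u 0 1 ∧ P.u 0 1 > P.u 0 0 ∧ P.u 0 0 > P.dA 0 * P.u 0 3 ∧
    P.dA 0 * P.u 0 3 > P.dA 0 * P.u 0 1 ∧ P.dA 0 * P.u 0 3 > P.dA 0 * P.u 0 0 ∧
    P.dA 0 * P.u 0 3 > P.u 0 2 ∧ P.dA 0 * P.u 0 3 > P.dA 0 * P.u 0 2 ∧
    P.dA 0 * P.u 0 3 > 0 ∧ P.u 0 2 < 0) ∧
  -- a2: b3 ≻ b4 ≻ b2 ≻ b1, δ close to 1
  (P.dA 1 < 1 ∧ (∀ j j' : Fin 4, P.u 1 j > P.u 1 j' → P.dA 1 * P.u 1 j > P.u 1 j') ∧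
    P.u 1 2 > P.u 1 3 ∧ P.u 1 3 > P.u 1 1 ∧ P.u 1 1 > P.u 1 0 ∧ P.u 1 0 > 0) ∧
  -- a3: (b3,0) ≻ (b2,0) ≻ (b3,1) ≻ all else
  (P.u 2 2 > P.u 2 1 ∧ P.u 2 1 > P.dA 2 * P.u 2 2 ∧
    P.dA 2 * P.u 2 2 > P.dA 2 * P.u 2 1 ∧ P.dA 2 * P.u 2 2 > P.u 2 0 ∧
    P.dA 2 * P.u 2 2 > P.dA 2 * P.u 2 0 ∧ P.dA 2 * P.u 2 2 > P.u 2 3 ∧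
    P.dA 2 * P.u 2 2 > P.dA 2 * P.u 2 3 ∧ P.dA 2 * P.u 2 2 > 0 ∧
    P.u 2 0 < 0 ∧ P.u 2 3 < 0) ∧
  -- a4: b3 ≻ b1 ≻ b4, b2 unacceptable
  (P.u 3 2 > P.u 3 0 ∧ P.u 3 0 > P.u 3 3 ∧ P.u 3 3 > 0 ∧ P.u 3 1 < 0) ∧
  -- b1: a4 ≻ a1 ≻ a2, δ close to 1, a3 unacceptable
  (P.dB 0 < 1 ∧ (∀ i i' : Fin 4, P.v i 0 > P.v i' 0 → P.dB 0 * P.v i 0 > P.v i' 0) ∧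
    P.v 3 0 > P.v 0 0 ∧ P.v 0 0 > P.v 1 0 ∧ P.v 1 0 > 0 ∧ P.v 2 0 < 0) ∧
  -- b2: (a2,0) ≻ (a2,1) ≻ (a3,0) ≻ (a1,0) ≻ (a3,1) ≻ all else
  (P.v 1 1 > P.dB 1 * P.v 1 1 ∧ P.dB 1 * P.v 1 1 > P.v 2 1 ∧ P.v 2 1 > P.v 0 1 ∧
    P.v 0 1 > P.dB 1 * P.v 2 1 ∧ P.dB 1 * P.v 2 1 > P.dB 1 * P.v 0 1 ∧
    P.dB 1 * P.v 2 1 > P.v 3 1 ∧ P.dB 1 * P.v 2 1 > P.dB 1 * P.v 3 1 ∧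
    P.dB 1 * P.v 2 1 > 0 ∧ P.v 3 1 < 0) ∧
  -- b3: a3 ≻ a4 ≻ a2, a1 unacceptable
  (P.v 2 2 > P.v 3 2 ∧ P.v 3 2 > P.v 1 2 ∧ P.v 1 2 > 0 ∧ P.v 0 2 < 0) ∧
  -- b4: a4 ≻ a2 ≻ a1, a3 unacceptable
  (P.v 3 3 > P.v 1 3 ∧ P.v 1 3 > P.v 0 3 ∧ P.v 0 3 > 0 ∧ P.v 2 3 < 0)

/-- The candidate matching `m*`: `a1–b1`, `a2–b2` in period 1; `a3–b3`, `a4–b4` in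
period 2. -/
def mstar1 : PreMatching (Fin 4) (Fin 4) where
  mA := fun t a => if t = 0 then (if a = 0 ∨ a = 1 then some a else none) else some a
  mB := fun t b => if t = 0 then (if b = 0 ∨ b = 1 then some b else none) else some b

/-! ### Schedules
A schedule records, for one agent, its eventual partner (if any) together with a flag
telling whether the match is delayed to the second period. -/

/-- The sequence of partners of an agent with schedule `o`. -/
def path (o : Option (Fin 4 × Bool)) (t : ℕ) : Option (Fin 4) :=
  o.bind fun p => if t = 0 ∧ p.2 = true then none else some p.1

/-- The matching in which all agents follow the given schedules. -/
def toMatching (f g : Fin 4 → Option (Fin 4 × Bool)) : PreMatching (Fin 4) (Fin 4) :=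
  ⟨fun t a => path (f a) t, fun t b => path (g b) t⟩

/-- The schedule forgetting that a match is delayed. -/
def undelay (o : Option (Fin 4 × Bool)) : Option (Fin 4 × Bool) :=
  o.map fun p => (p.1, false)

/-- The discounted value of a schedule. -/
def val (d : ℝ) (w : Fin 4 → ℝ) : Option (Fin 4 × Bool) → ℝ
  | none => 0
  | some (x, false) => w x
  | some (x, true) => d * w x

/-- The payoff in period `t` from the sequence of partners `μ` up to the horizon `T`. -/
def pathPay (T : ℕ) (d : ℝ) (w : Fin 4 → ℝ) (μ : ℕ → Option (Fin 4)) (t : ℕ) : ℝ :=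
  match μ (T - 1) with
  | none => 0
  | some x => d ^ (min (sInf {s | t ≤ s ∧ μ s ≠ none}) T - t) * w x

theorem Upay_eq (P : Pref (Fin 4) (Fin 4)) (E : Economy (Fin 4) (Fin 4))
    (m : PreMatching (Fin 4) (Fin 4)) (t : ℕ) (a : Fin 4) :
    Upay P E m t a = pathPay E.T (P.dA a) (P.u a) (fun s => m.mA s a) t := by
  unfold Upay pathPay matchTimeA
  cases h : m.mA (E.T - 1) a <;> simp [h]

theorem Vpay_eq (P : Pref (Fin 4) (Fin 4)) (E : Economy (Fin 4) (Fin 4))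
    (m : PreMatching (Fin 4) (Fin 4)) (t : ℕ) (b : Fin 4) :
    Vpay P E m t b = pathPay E.T (P.dB b) (fun a => P.v a b) (fun s => m.mB s b) t := by
  unfold Vpay pathPay matchTimeB
  cases h : m.mB (E.T - 1) b <;> simp [h]

theorem sInf_firstMatch {μ : ℕ → Option (Fin 4)} {t n : ℕ} (htn : t ≤ n) (hn : μ n ≠ none)
    (h : ∀ s, t ≤ s → s < n → μ s = none) : sInf {s | t ≤ s ∧ μ s ≠ none} = n := by
  refine le_antisymm (Nat.sInf_le ⟨htn, hn⟩) ?_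
  have hmem := Nat.sInf_mem (s := {s | t ≤ s ∧ μ s ≠ none}) ⟨n, htn, hn⟩
  by_contra hlt
  exact hmem.2 (h _ hmem.1 (not_le.mp hlt))

theorem pathPay_two_zero (d : ℝ) (w : Fin 4 → ℝ) (o : Option (Fin 4 × Bool)) :
    pathPay 2 d w (path o) 0 = val d w o := by
  rcases o with _ | ⟨x, _ | _⟩
  · simp [pathPay, path, val]
  · have := sInf_firstMatch (μ := path (some (x, false))) (t := 0) (n := 0) le_rfl
      (by simp [path]) (by simp)
    simp only [pathPay, this]
    simp [path, val]
  · have := sInf_firstMatch (μ := path (some (x, true))) (t := 0) (n := 1) zero_le_one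
      (by simp [path]) (by intro s _ hs; obtain rfl : s = 0 := by omega
                           simp [path])
    simp only [pathPay, this]
    simp [path, val]

theorem pathPay_two_one (d : ℝ) (w : Fin 4 → ℝ) (o : Option (Fin 4 × Bool)) :
    pathPay 2 d w (path o) 1 = val d w (undelay o) := by
  rcases o with _ | ⟨x, e⟩
  · simp [pathPay, path, val, undelay]
  · have := sInf_firstMatch (μ := path (some (x, e))) (t := 1) (n := 1) le_rfl
      (by simp [path]) (by omega)
    simp only [pathPay, this]
    simp [path, val, undelay]

theorem pathPay_one_zero (d : ℝ) (w : Fin 4 → ℝ) (μ : ℕ → Option (Fin 4)) :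
    pathPay 1 d w μ 0 = val d w ((μ 0).map fun x => (x, false)) := by
  rcases h : μ 0 with _ | x
  · simp [pathPay, val, h]
  · have := sInf_firstMatch (μ := μ) (t := 0) (n := 0) le_rfl (by simp [h]) (by simp)
    simp only [pathPay, this]
    simp [val, h]

/-! ### Ranks of schedules -/

/-- Ranks of schedules of side-`A` agents (`-1` if unacceptable, `100` if not ranked). -/
def rankA : Fin 4 → Option (Fin 4 × Bool) → ℤ
  | _, none => 0
  | 0, some (b, false) => ![4, 5, -1, 6] b
  | 0, some (b, true) => ![1, 2, -1, 3] b
  | 1, some (b, false) => ![2, 4, 8, 6] b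
  | 1, some (b, true) => ![1, 3, 7, 5] b
  | 2, some (b, false) => ![-1, 3, 4, -1] b
  | 2, some (b, true) => ![-1, 1, 2, -1] b
  | 3, some (b, false) => ![2, -1, 3, 1] b
  | 3, some (_, true) => 100

/-- Ranks of schedules of side-`B` agents (`-1` if unacceptable, `100` if not ranked). -/
def rankB : Fin 4 → Option (Fin 4 × Bool) → ℤ
  | _, none => 0
  | 0, some (a, false) => ![4, 2, -1, 6] a
  | 0, some (a, true) => ![3, 1, -1, 5] a
  | 1, some (a, false) => ![3, 6, 4, -1] a
  | 1, some (a, true) => ![1, 5, 2, -1] a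
  | 2, some (a, false) => ![-1, 1, 3, 2] a
  | 3, some (a, false) => ![1, 2, -1, 3] a
  | 2, some (_, true) => 100
  | 3, some (_, true) => 100

/-- `r x ≤ r y`, where `y` is acceptable and ranked. -/
def RankLE (r : Option (Fin 4 × Bool) → ℤ) (x y : Option (Fin 4 × Bool)) : Prop :=
  0 ≤ r y ∧ r x ≤ r y ∧ r y < 100

instance (r : Option (Fin 4 × Bool) → ℤ) (x y : Option (Fin 4 × Bool)) :
    Decidable (RankLE r x y) :=
  inferInstanceAs (Decidable (_ ∧ _ ∧ _))

theorem pos_of_mul_pos_of_nonneg {d x : ℝ} (hd : 0 ≤ d) (h : 0 < d * x) : 0 < d :=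
  hd.lt_of_ne' fun h0 => by simp [h0] at h

set_option maxHeartbeats 4000000 in
theorem valA_le {P : Pref (Fin 4) (Fin 4)} (hP : Ex1Pref P) (a : Fin 4)
    {x y : Option (Fin 4 × Bool)} (h : RankLE (rankA a) x y) :
    val (P.dA a) (P.u a) x ≤ val (P.dA a) (P.u a) y := by
  obtain ⟨⟨hA, -⟩, h0, ⟨h1, h1', h1''⟩, h2, h3, -⟩ := hP
  obtain ⟨hy, hxy, hy'⟩ := h
  have hd := hA a
  match a with
  | 0 =>
    have hpos := pos_of_mul_pos_of_nonneg hd.1 h0.2.2.2.2.2.2.2.1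
    have e1 : P.dA 0 * P.u 0 0 < P.dA 0 * P.u 0 1 := mul_lt_mul_of_pos_left h0.2.1 hpos
    have e2 : 0 < P.dA 0 * P.u 0 0 := mul_pos hpos (by linarith)
    have e3 : P.dA 0 * P.u 0 2 < 0 := mul_neg_of_pos_of_neg hpos (by linarith)
    rcases x with _ | ⟨x, _ | _⟩ <;> rcases y with _ | ⟨y, _ | _⟩ <;>
      (try fin_cases x) <;> (try fin_cases y) <;> simp [rankA, val] at hy hxy hy' ⊢ <;> linarith
  | 1 =>
    have e0 : P.u 1 0 > 0 := by linarith
    have f1 := h1' 2 3 (by linarith)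
    have f2 := h1' 3 1 (by linarith)
    have f3 := h1' 1 0 (by linarith)
    have g0 : P.dA 1 * P.u 1 0 < P.u 1 0 := by nlinarith
    have g1 : P.dA 1 * P.u 1 1 < P.u 1 1 := by nlinarith
    have g2 : P.dA 1 * P.u 1 2 < P.u 1 2 := by nlinarith
    have g3 : P.dA 1 * P.u 1 3 < P.u 1 3 := by nlinarith
    have g4 : 0 < P.dA 1 * P.u 1 0 :=
      mul_pos (pos_of_mul_pos_of_nonneg hd.1 (x := P.u 1 1) (by linarith)) e0
    rcases x with _ | ⟨x, _ | _⟩ <;> rcases y with _ | ⟨y, _ | _⟩ <;>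
      (try fin_cases x) <;> (try fin_cases y) <;> simp [rankA, val] at hy hxy hy' ⊢ <;> linarith
  | 2 =>
    have hpos := pos_of_mul_pos_of_nonneg hd.1 h2.2.2.2.2.2.2.2.1
    have e1 : 0 < P.dA 2 * P.u 2 1 := mul_pos hpos (by linarith)
    have e2 : P.dA 2 * P.u 2 0 < 0 := mul_neg_of_pos_of_neg hpos (by linarith)
    have e3 : P.dA 2 * P.u 2 3 < 0 := mul_neg_of_pos_of_neg hpos (by linarith)
    rcases x with _ | ⟨x, _ | _⟩ <;> rcases y with _ | ⟨y, _ | _⟩ <;>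
      (try fin_cases x) <;> (try fin_cases y) <;> simp [rankA, val] at hy hxy hy' ⊢ <;> linarith
  | 3 =>
    rcases x with _ | ⟨x, _ | _⟩ <;> rcases y with _ | ⟨y, _ | _⟩ <;>
      (try fin_cases x) <;> (try fin_cases y) <;> simp [rankA, val] at hy hxy hy' ⊢ <;> linarith

set_option maxHeartbeats 4000000 in
theorem valB_le {P : Pref (Fin 4) (Fin 4)} (hP : Ex1Pref P) (b : Fin 4)
    {x y : Option (Fin 4 × Bool)} (h : RankLE (rankB b) x y) :
    val (P.dB b) (fun a => P.v a b) x ≤ val (P.dB b) (fun a => P.v a b) y := by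
  obtain ⟨⟨-, hB⟩, -, -, -, -, ⟨h0, h0', h0''⟩, h1, h2, h3⟩ := hP
  obtain ⟨hy, hxy, hy'⟩ := h
  have hd := hB b
  match b with
  | 0 =>
    have f1 := h0' 3 0 (by linarith)
    have f2 := h0' 0 1 (by linarith)
    have hpos := pos_of_mul_pos_of_nonneg hd.1 (x := P.v 0 0) (by linarith)
    have g0 : P.dB 0 * P.v 0 0 < P.v 0 0 := by nlinarith
    have g1 : P.dB 0 * P.v 1 0 < P.v 1 0 := by nlinarith
    have g3 : P.dB 0 * P.v 3 0 < P.v 3 0 := by nlinarith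
    have g4 : 0 < P.dB 0 * P.v 1 0 := mul_pos hpos (by linarith)
    have g2 : P.dB 0 * P.v 2 0 < 0 := mul_neg_of_pos_of_neg hpos (by linarith)
    rcases x with _ | ⟨x, _ | _⟩ <;> rcases y with _ | ⟨y, _ | _⟩ <;>
      (try fin_cases x) <;> (try fin_cases y) <;> simp [rankB, val] at hy hxy hy' ⊢ <;> linarith
  | 1 =>
    have hpos := pos_of_mul_pos_of_nonneg hd.1 h1.2.2.2.2.2.2.2.1
    have e1 : 0 < P.dB 1 * P.v 0 1 := mul_pos hpos (by linarith)
    have e2 : P.dB 1 * P.v 3 1 < 0 := mul_neg_of_pos_of_neg hpos (by linarith)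
    rcases x with _ | ⟨x, _ | _⟩ <;> rcases y with _ | ⟨y, _ | _⟩ <;>
      (try fin_cases x) <;> (try fin_cases y) <;> simp [rankB, val] at hy hxy hy' ⊢ <;> linarith
  | 2 =>
    rcases x with _ | ⟨x, _ | _⟩ <;> rcases y with _ | ⟨y, _ | _⟩ <;>
      (try fin_cases x) <;> (try fin_cases y) <;> simp [rankB, val] at hy hxy hy' ⊢ <;> linarith
  | 3 =>
    rcases x with _ | ⟨x, _ | _⟩ <;> rcases y with _ | ⟨y, _ | _⟩ <;>
      (try fin_cases x) <;> (try fin_cases y) <;> simp [rankB, val] at hy hxy hy' ⊢ <;> linarith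

/-! ### Stable matchings of the static markets -/

/-- The mutually acceptable pairs, listed compatibly with all preferences. -/
def acceptablePairs : List (Fin 4 × Fin 4) :=
  [(2, 2), (3, 2), (1, 2), (3, 0), (3, 3), (1, 3), (0, 3), (1, 1), (2, 1), (0, 1), (0, 0), (1, 0)]

/-- The greedy matching of `X` and `Y` along `acceptablePairs`. -/
def greedy (X Y : Finset (Fin 4)) : List (Fin 4 × Fin 4) :=
  acceptablePairs.foldl
    (fun l p => if p.1 ∈ X ∧ p.2 ∈ Y ∧ ∀ q ∈ l, q.1 ≠ p.1 ∧ q.2 ≠ p.2 then p :: l else l) []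

/-- The partner of `a` in a list of pairs. -/
def partnerA (l : List (Fin 4 × Fin 4)) (a : Fin 4) : Option (Fin 4) :=
  (l.find? fun p => p.1 = a).map Prod.snd

/-- The partner of `b` in a list of pairs. -/
def partnerB (l : List (Fin 4 × Fin 4)) (b : Fin 4) : Option (Fin 4) :=
  (l.find? fun p => p.2 = b).map Prod.fst

/-- Stability, in terms of ranks, of a static matching of `X` and `Y`. -/
def RankStable (X Y : Finset (Fin 4)) (p q : Fin 4 → Option (Fin 4)) : Prop :=
  (∀ a b, p a = some b ↔ q b = some a) ∧
  (∀ a b, p a = some b → a ∈ X ∧ b ∈ Y) ∧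
  (∀ a, RankLE (rankA a) none ((p a).map fun b => (b, false))) ∧
  (∀ b, RankLE (rankB b) none ((q b).map fun a => (a, false))) ∧
  (∀ a ∈ X, ∀ b ∈ Y,
    RankLE (rankA a) (some (b, false)) ((p a).map fun b => (b, false)) ∨
    RankLE (rankB b) (some (a, false)) ((q b).map fun a => (a, false)))

instance (X Y : Finset (Fin 4)) (p q : Fin 4 → Option (Fin 4)) :
    Decidable (RankStable X Y p q) :=
  inferInstanceAs (Decidable (_ ∧ _ ∧ _ ∧ _ ∧ _))

theorem rankStable_greedy : ∀ X Y : Finset (Fin 4),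
    RankStable X Y (partnerA (greedy X Y)) (partnerB (greedy X Y)) := by
  decide +kernel

/-! ### Economies with arrivals split between two periods -/

/-- The length-2 economy in which `X` and `Y` arrive first and all others second. -/
def splitEconomy (X Y : Finset (Fin 4)) : Economy (Fin 4) (Fin 4) where
  T := 2
  arrA := fun s => if s = 0 then X else if s = 1 then Finset.univ \ X else ∅
  arrB := fun s => if s = 0 then Y else if s = 1 then Finset.univ \ Y else ∅

/-- The schedules `f` and `g` match with each other, and early matches only involve
agents of `X` and `Y`. -/
def Consistent (X Y : Finset (Fin 4)) (f g : Fin 4 → Option (Fin 4 × Bool)) : Prop :=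
  (∀ a b d, f a = some (b, d) ↔ g b = some (a, d)) ∧
  (∀ a b, f a = some (b, false) → a ∈ X ∧ b ∈ Y)

instance (X Y : Finset (Fin 4)) (f g : Fin 4 → Option (Fin 4 × Bool)) :
    Decidable (Consistent X Y f g) :=
  inferInstanceAs (Decidable (_ ∧ _))

/-- Solutions of the split economies, as the schedules of both sides. -/
def sol (X Y : Finset (Fin 4)) :
    (Fin 4 → Option (Fin 4 × Bool)) × (Fin 4 → Option (Fin 4 × Bool)) :=
  if X = {0, 1, 2} ∧ Y = {0, 1} then
    (![some (0, false), some (1, false), some (2, true), some (3, true)],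
      ![some (0, false), some (1, false), some (2, true), some (3, true)])
  else if X = {0, 2} ∧ Y = {0, 1} then
    (![some (0, false), some (1, true), some (2, true), some (3, true)],
      ![some (0, false), some (1, true), some (2, true), some (3, true)])
  else if 1 ∈ Y ∧ 2 ∈ X then
    (![some (0, true), some (3, true), some (1, false), some (2, true)],
      ![some (0, true), some (2, false), some (3, true), some (1, true)])
  else if 1 ∈ Y ∧ 0 ∈ X then
    (![some (1, false), some (3, true), some (2, true), some (0, true)],
      ![some (3, true), some (0, false), some (2, true), some (1, true)])
  else
    (![some (1, true), some (3, true), some (2, true), some (0, true)],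
      ![some (3, true), some (0, true), some (2, true), some (1, true)])

/-- Side-`A` schedules of `sol`. -/
def solA (X Y : Finset (Fin 4)) : Fin 4 → Option (Fin 4 × Bool) := (sol X Y).1

/-- Side-`B` schedules of `sol`. -/
def solB (X Y : Finset (Fin 4)) : Fin 4 → Option (Fin 4 × Bool) := (sol X Y).2

/-- The conditions on ranks making `sol X Y` a rational expectations solution, provided
`sol` is one in the economies in which one agent is delayed. -/
def RankSolution (X Y : Finset (Fin 4)) : Prop :=
  Consistent X Y (solA X Y) (solB X Y) ∧
  (∀ a ∈ X, RankLE (rankA a) (solA (X \ {a}) Y a) (solA X Y a)) ∧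
  (∀ b ∈ Y, RankLE (rankB b) (solB X (Y \ {b}) b) (solB X Y b)) ∧
  (∀ a ∈ X, ∀ b ∈ Y, RankLE (rankA a) (some (b, false)) (solA X Y a) ∨
    RankLE (rankB b) (some (a, false)) (solB X Y b)) ∧
  (∀ a, RankLE (rankA a) none (undelay (solA X Y a))) ∧
  (∀ b, RankLE (rankB b) none (undelay (solB X Y b))) ∧
  (∀ a b, path (solA X Y a) 0 = none → path (solB X Y b) 0 = none →
    RankLE (rankA a) (some (b, false)) (undelay (solA X Y a)) ∨
    RankLE (rankB b) (some (a, false)) (undelay (solB X Y b)))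

instance (X Y : Finset (Fin 4)) : Decidable (RankSolution X Y) :=
  inferInstanceAs (Decidable (_ ∧ _ ∧ _ ∧ _ ∧ _ ∧ _ ∧ _))

theorem rankSolution_sol : ∀ X Y : Finset (Fin 4), X ⊆ {0, 1, 2} → Y ⊆ {0, 1} →
    RankSolution X Y := by
  decide +kernel

theorem mem_arrAUpTo_splitEconomy_one (X Y : Finset (Fin 4)) (a : Fin 4) :
    a ∈ arrAUpTo (splitEconomy X Y) 1 := by
  by_cases h : a ∈ X
  · exact Finset.mem_biUnion.2 ⟨0, by simp, by simpa [splitEconomy] using h⟩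
  · exact Finset.mem_biUnion.2 ⟨1, by simp, by simpa [splitEconomy] using h⟩

theorem mem_arrBUpTo_splitEconomy_one (X Y : Finset (Fin 4)) (b : Fin 4) :
    b ∈ arrBUpTo (splitEconomy X Y) 1 := by
  by_cases h : b ∈ Y
  · exact Finset.mem_biUnion.2 ⟨0, by simp, by simpa [splitEconomy] using h⟩
  · exact Finset.mem_biUnion.2 ⟨1, by simp, by simpa [splitEconomy] using h⟩

theorem arrAUpTo_zero (E : Economy (Fin 4) (Fin 4)) : arrAUpTo E 0 = E.arrA 0 := by
  simp [arrAUpTo]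

theorem arrBUpTo_zero (E : Economy (Fin 4) (Fin 4)) : arrBUpTo E 0 = E.arrB 0 := by
  simp [arrBUpTo]

theorem availA_zero (E : Economy (Fin 4) (Fin 4)) (m : PreMatching (Fin 4) (Fin 4)) :
    availA E m 0 = E.arrA 0 := by
  simp [availA, arrAUpTo_zero]

theorem availB_zero (E : Economy (Fin 4) (Fin 4)) (m : PreMatching (Fin 4) (Fin 4)) :
    availB E m 0 = E.arrB 0 := by
  simp [availB, arrBUpTo_zero]

theorem path_zero_eq_some {o : Option (Fin 4 × Bool)} {x : Fin 4} :
    path o 0 = some x ↔ o = some (x, false) := by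
  rcases o with _ | ⟨y, _ | _⟩ <;> simp [path]

theorem path_zero_eq_none {o : Option (Fin 4 × Bool)} :
    path o 0 = none ↔ ∀ x, o ≠ some (x, false) := by
  rcases o with _ | ⟨y, _ | _⟩ <;> simp [path]

theorem path_one (o : Option (Fin 4 × Bool)) : path o 1 = o.map Prod.fst := by
  rcases o with _ | ⟨y, _ | _⟩ <;> simp [path]

theorem path_one_eq_some {o : Option (Fin 4 × Bool)} {x : Fin 4} :
    path o 1 = some x ↔ ∃ d, o = some (x, d) := by
  rcases o with _ | ⟨y, d⟩ <;> simp [path]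

theorem path_eq_of_le {o : Option (Fin 4 × Bool)} {t s : ℕ} (hts : t ≤ s)
    (h : path o t ≠ none) : path o s = path o t := by
  rcases o with _ | ⟨y, _ | _⟩
  · rfl
  · simp [path]
  · have ht : t ≠ 0 := by rintro rfl; simp [path] at h
    have hs : s ≠ 0 := by omega
    simp [path, ht, hs]

theorem isMatching_toMatching {X Y : Finset (Fin 4)} {f g : Fin 4 → Option (Fin 4 × Bool)}
    (h : Consistent X Y f g) : IsMatching (splitEconomy X Y) (toMatching f g) := by
  have ht2 : ∀ t, t < (splitEconomy X Y).T → t = 0 ∨ t = 1 := by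
    intro t ht
    change t < 2 at ht
    omega
  refine ⟨?_, ?_, ?_, fun t s a hts _ hn => path_eq_of_le hts hn,
    fun t s b hts _ hn => path_eq_of_le hts hn⟩
  · intro t a b ht
    obtain rfl | rfl := ht2 t ht
    · simp only [toMatching, path_zero_eq_some, h.1]
    · simp only [toMatching, path_one_eq_some, h.1]
  · intro t a ht hn
    obtain rfl | rfl := ht2 t ht
    · obtain ⟨b, hb⟩ := Option.ne_none_iff_exists'.1 hn
      rw [arrAUpTo_zero]
      exact (h.2 a b (path_zero_eq_some.1 hb)).1
    · exact mem_arrAUpTo_splitEconomy_one X Y a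
  · intro t a b ht hb
    obtain rfl | rfl := ht2 t ht
    · rw [arrBUpTo_zero]
      exact (h.2 a b (path_zero_eq_some.1 hb)).2
    · exact mem_arrBUpTo_splitEconomy_one X Y b

theorem Upay_toMatching_zero (P : Pref (Fin 4) (Fin 4)) (X Y : Finset (Fin 4))
    (f g : Fin 4 → Option (Fin 4 × Bool)) (a : Fin 4) :
    Upay P (splitEconomy X Y) (toMatching f g) 0 a = val (P.dA a) (P.u a) (f a) := by
  rw [Upay_eq]
  exact pathPay_two_zero _ _ _

theorem Vpay_toMatching_zero (P : Pref (Fin 4) (Fin 4)) (X Y : Finset (Fin 4))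
    (f g : Fin 4 → Option (Fin 4 × Bool)) (b : Fin 4) :
    Vpay P (splitEconomy X Y) (toMatching f g) 0 b =
      val (P.dB b) (fun a => P.v a b) (g b) := by
  rw [Vpay_eq]
  exact pathPay_two_zero _ _ _

theorem Upay_toMatching_one (P : Pref (Fin 4) (Fin 4)) (X Y : Finset (Fin 4))
    (f g : Fin 4 → Option (Fin 4 × Bool)) (a : Fin 4) :
    Upay P (splitEconomy X Y) (toMatching f g) 1 a =
      val (P.dA a) (P.u a) (undelay (f a)) := by
  rw [Upay_eq]
  exact pathPay_two_one _ _ _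

theorem Vpay_toMatching_one (P : Pref (Fin 4) (Fin 4)) (X Y : Finset (Fin 4))
    (f g : Fin 4 → Option (Fin 4 × Bool)) (b : Fin 4) :
    Vpay P (splitEconomy X Y) (toMatching f g) 1 b =
      val (P.dB b) (fun a => P.v a b) (undelay (g b)) := by
  rw [Vpay_eq]
  exact pathPay_two_one _ _ _

theorem stable1_of_rankStable {P : Pref (Fin 4) (Fin 4)} (hP : Ex1Pref P)
    {E : Economy (Fin 4) (Fin 4)} (hT : E.T = 1) {p q : Fin 4 → Option (Fin 4)}
    (h : RankStable (E.arrA 0) (E.arrB 0) p q) {m : PreMatching (Fin 4) (Fin 4)}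
    (hmA : ∀ a, m.mA 0 a = p a) (hmB : ∀ b, m.mB 0 b = q b) : Stable1 P E m := by
  obtain ⟨hpq, harr, hirA, hirB, hblock⟩ := h
  have hU : ∀ a, Upay P E m 0 a = val (P.dA a) (P.u a) ((p a).map fun b => (b, false)) := by
    intro a
    rw [Upay_eq, hT, pathPay_one_zero, hmA]
  have hV : ∀ b, Vpay P E m 0 b =
      val (P.dB b) (fun a => P.v a b) ((q b).map fun a => (a, false)) := by
    intro b
    rw [Vpay_eq, hT, pathPay_one_zero, hmB]
  refine ⟨⟨?_, ?_, ?_, ?_, ?_⟩, ?_, ?_, ?_⟩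
  · intro t a b ht
    obtain rfl : t = 0 := by omega
    rw [hmA, hmB, hpq]
  · intro t a ht hn
    obtain rfl : t = 0 := by omega
    obtain ⟨b, hb⟩ := Option.ne_none_iff_exists'.1 hn
    rw [arrAUpTo_zero]
    exact (harr a b (by rw [← hmA, hb])).1
  · intro t a b ht hb
    obtain rfl : t = 0 := by omega
    rw [arrBUpTo_zero]
    exact (harr a b (by rw [← hmA, hb])).2
  · intro t s a hts hs _
    obtain rfl : t = s := by omega
    rfl
  · intro t s b hts hs _
    obtain rfl : t = s := by omega
    rfl
  · intro a b hab
    simp only [hT, Nat.sub_self, hmA] at hab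
    simpa [hab, val] using valA_le hP a (hirA a)
  · intro b a hba
    simp only [hT, Nat.sub_self, hmB] at hba
    simpa [hba, val] using valB_le hP b (hirB b)
  · intro a ha b hb hlt
    rw [hU, hV] at hlt
    rcases hblock a ha b hb with h | h
    · exact not_lt.2 (valA_le hP a h) hlt.1
    · exact not_lt.2 (valB_le hP b h) hlt.2

/-- The schedule following `o` if it is early, and otherwise matching late as in `p`. -/
def replan (o : Option (Fin 4 × Bool)) (p : Option (Fin 4)) : Option (Fin 4 × Bool) :=
  if path o 0 = none then p.map fun x => (x, true) else o

theorem path_replan_zero (o : Option (Fin 4 × Bool)) (p : Option (Fin 4)) :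
    path (replan o p) 0 = path o 0 := by
  by_cases h : path o 0 = none
  · cases p <;> simp [replan, h] <;> simp [path]
  · simp [replan, h]

theorem replan_of_path_eq_none {o : Option (Fin 4 × Bool)} (h : path o 0 = none)
    (p : Option (Fin 4)) : replan o p = p.map fun x => (x, true) := by
  simp [replan, h]

/-- If the late part of a matching is replaced by the greedy matching of some late agents,
the continuation is stable. -/
theorem exists_replanned {P : Pref (Fin 4) (Fin 4)} (hP : Ex1Pref P)
    {X Y X' Y' : Finset (Fin 4)} {f g : Fin 4 → Option (Fin 4 × Bool)}
    (h : Consistent X Y f g) (hX' : ∀ a ∈ X', path (f a) 0 = none)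
    (hY' : ∀ b ∈ Y', path (g b) 0 = none) :
    ∃ f' g', IsMatching (splitEconomy X Y) (toMatching f' g') ∧
      agreeUpTo (toMatching f g) (toMatching f' g') 1 ∧
      (∀ a, a ∉ X' → path (f a) 0 = none → f' a = none) ∧
      (∀ b, b ∉ Y' → path (g b) 0 = none → g' b = none) ∧
      ∀ E : Economy (Fin 4) (Fin 4), E.T = 1 → E.arrA 0 = X' → E.arrB 0 = Y' →
        Stable1 P E (restrictM (toMatching f' g') 1) := by
  have hst := rankStable_greedy X' Y'
  generalize partnerA (greedy X' Y') = p at hst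
  generalize partnerB (greedy X' Y') = q at hst
  obtain ⟨hpq, harr, -⟩ := id hst
  have hp : ∀ a, a ∉ X' → p a = none := fun a ha =>
    Option.eq_none_iff_forall_ne_some.2 fun b hb => ha (harr a b hb).1
  have hq : ∀ b, b ∉ Y' → q b = none := fun b hb =>
    Option.eq_none_iff_forall_ne_some.2 fun a ha => hb (harr a b ((hpq a b).2 ha)).2
  refine ⟨fun a => replan (f a) (p a), fun b => replan (g b) (q b),
    isMatching_toMatching ⟨?_, ?_⟩, ?_, ?_, ?_, ?_⟩
  · rintro a b (_ | _)
    · rw [← path_zero_eq_some, ← path_zero_eq_some, path_replan_zero, path_replan_zero,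
        path_zero_eq_some, path_zero_eq_some, h.1]
    · have key : ∀ (o : Option (Fin 4 × Bool)) (r : Option (Fin 4)) (x : Fin 4),
          (r ≠ none → path o 0 = none) → (replan o r = some (x, true) ↔ r = some x) := by
        intro o r x hr
        rcases r with _ | y
        · rcases o with _ | ⟨z, _ | _⟩ <;> simp [replan, path]
        · simp [replan, hr]
      rw [key, key, hpq]
      · exact fun hn => hY' b (by_contra fun hb => hn (hq b hb))
      · exact fun hn => hX' a (by_contra fun ha => hn (hp a ha))
  · intro a b hab
    rw [← path_zero_eq_some, path_replan_zero, path_zero_eq_some] at hab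
    exact h.2 a b hab
  · intro s hs
    obtain rfl : s = 0 := by omega
    exact ⟨fun a => (path_replan_zero _ _).symm, fun b => (path_replan_zero _ _).symm⟩
  · intro a ha hn
    simp [replan_of_path_eq_none hn, hp a ha]
  · intro b hb hn
    simp [replan_of_path_eq_none hn, hq b hb]
  · rintro E hT rfl rfl
    refine stable1_of_rankStable hP hT hst ?_ ?_
    · intro a
      by_cases hn : path (f a) 0 = none
      · cases hpa : p a <;>
          simp [restrictM, toMatching, path_replan_zero, hn, path_one, replan_of_path_eq_none,
            hpa]
      · simpa [restrictM, toMatching, path_replan_zero, hn] using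
          (hp a fun ha => hn (hX' a ha)).symm
    · intro b
      by_cases hn : path (g b) 0 = none
      · cases hqb : q b <;>
          simp [restrictM, toMatching, path_replan_zero, hn, path_one, replan_of_path_eq_none,
            hqb]
      · simpa [restrictM, toMatching, path_replan_zero, hn] using
          (hq b fun hb => hn (hY' b hb)).symm

theorem restrictM_zero (m : PreMatching (Fin 4) (Fin 4)) : restrictM m 0 = m := by
  simp [restrictM]

theorem contEconomy_splitEconomy_zero (X Y : Finset (Fin 4))
    (m : PreMatching (Fin 4) (Fin 4)) :
    contEconomy (splitEconomy X Y) m 0 = splitEconomy X Y := by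
  refine congrArg₂ (Economy.mk 2) ?_ ?_ <;> funext s <;> by_cases h : s = 0 <;>
    simp [h, availA_zero, availB_zero, splitEconomy]

theorem delayEconomy_splitEconomy_inl {X Y : Finset (Fin 4)} {a : Fin 4} (ha : a ∈ X) :
    delayEconomy (splitEconomy X Y) (Sum.inl a) = splitEconomy (X \ {a}) Y := by
  refine congrArg₂ (Economy.mk 2) ?_ rfl
  funext s
  ext x
  by_cases h0 : s = 0 <;> by_cases h1 : s = 1 <;> by_cases hx : x = a <;>
    simp [splitEconomy, h0, h1, hx, ha]

theorem delayEconomy_splitEconomy_inr {X Y : Finset (Fin 4)} {b : Fin 4} (hb : b ∈ Y) :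
    delayEconomy (splitEconomy X Y) (Sum.inr b) = splitEconomy X (Y \ {b}) := by
  refine congrArg₂ (Economy.mk 2) rfl ?_
  funext s
  ext x
  by_cases h0 : s = 0 <;> by_cases h1 : s = 1 <;> by_cases hx : x = b <;>
    simp [splitEconomy, h0, h1, hx, hb]

theorem path_zero_eq_none_of_mem_availA {E : Economy (Fin 4) (Fin 4)}
    {f g : Fin 4 → Option (Fin 4 × Bool)} {a : Fin 4}
    (h : a ∈ availA E (toMatching f g) 1) : path (f a) 0 = none :=
  (Finset.mem_filter.1 h).2 0 one_pos

theorem path_zero_eq_none_of_mem_availB {E : Economy (Fin 4) (Fin 4)}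
    {f g : Fin 4 → Option (Fin 4 × Bool)} {b : Fin 4}
    (h : b ∈ availB E (toMatching f g) 1) : path (g b) 0 = none :=
  (Finset.mem_filter.1 h).2 0 one_pos

theorem sol_mem_RE {P : Pref (Fin 4) (Fin 4)} (hP : Ex1Pref P)
    {RE : Economy (Fin 4) (Fin 4) → Set (PreMatching (Fin 4) (Fin 4))}
    (hRE : IsREFamily P RE) (X Y : Finset (Fin 4)) (hX : X ⊆ {0, 1, 2}) (hY : Y ⊆ {0, 1}) :
    toMatching (solA X Y) (solB X Y) ∈ RE (splitEconomy X Y) := by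
  obtain ⟨hC, hA0, hB0, hblock0, hA1, hB1, hblock1⟩ := rankSolution_sol X Y hX hY
  rw [hRE.2 _ le_rfl]
  refine ⟨isMatching_toMatching hC, fun t ht => ?_⟩
  obtain rfl | rfl : t = 0 ∨ t = 1 := by
    change t < 2 at ht
    omega
  · rw [availA_zero, availB_zero]
    change (∀ a ∈ X, _) ∧ (∀ b ∈ Y, _) ∧ ∀ a ∈ X, ∀ b ∈ Y, _
    refine ⟨fun a ha => ?_, fun b hb => ?_, fun a ha b hb hlt => ?_⟩
    · have hX' : X \ {a} ⊆ {0, 1, 2} := Finset.sdiff_subset.trans hX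
      have hC' := (rankSolution_sol (X \ {a}) Y hX' hY).1
      refine ⟨toMatching (solA (X \ {a}) Y) (solB (X \ {a}) Y), ⟨⟨isMatching_toMatching
        ⟨hC'.1, fun a b hab => ⟨Finset.sdiff_subset (hC'.2 a b hab).1, (hC'.2 a b hab).2⟩⟩,
        fun s hs => absurd hs (Nat.not_lt_zero s), ?_⟩, ?_⟩, ?_⟩
      · intro s hs
        obtain rfl : s = 0 := by omega
        exact path_zero_eq_none.2 fun b hb => by simpa using (hC'.2 a b hb).1
      · rw [restrictM_zero, contEconomy_splitEconomy_zero, delayEconomy_splitEconomy_inl ha]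
        exact sol_mem_RE hP hRE _ _ hX' hY
      · rw [Upay_toMatching_zero, Upay_toMatching_zero]
        exact valA_le hP a (hA0 a ha)
    · have hY' : Y \ {b} ⊆ {0, 1} := Finset.sdiff_subset.trans hY
      have hC' := (rankSolution_sol X (Y \ {b}) hX hY').1
      refine ⟨toMatching (solA X (Y \ {b})) (solB X (Y \ {b})), ⟨⟨isMatching_toMatching
        ⟨hC'.1, fun a b hab => ⟨(hC'.2 a b hab).1, Finset.sdiff_subset (hC'.2 a b hab).2⟩⟩,
        fun s hs => absurd hs (Nat.not_lt_zero s), ?_⟩, ?_⟩, ?_⟩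
      · intro s hs
        obtain rfl : s = 0 := by omega
        exact path_zero_eq_none.2 fun a ha => by
          simpa using (hC'.2 a b ((hC'.1 a b false).2 ha)).2
      · rw [restrictM_zero, contEconomy_splitEconomy_zero, delayEconomy_splitEconomy_inr hb]
        exact sol_mem_RE hP hRE _ _ hX hY'
      · rw [Vpay_toMatching_zero, Vpay_toMatching_zero]
        exact valB_le hP b (hB0 b hb)
    · rw [Upay_toMatching_zero, Vpay_toMatching_zero] at hlt
      rcases hblock0 a ha b hb with h | h
      · exact not_lt.2 (valA_le hP a h) hlt.1
      · exact not_lt.2 (valB_le hP b h) hlt.2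
  · refine ⟨fun a ha => ?_, fun b hb => ?_, fun a ha b hb hlt => ?_⟩
    · have hn := path_zero_eq_none_of_mem_availA ha
      obtain ⟨f', g', hm, hagree, hf', -, hstable⟩ := exists_replanned hP hC
        (X' := availA (splitEconomy X Y) (toMatching (solA X Y) (solB X Y)) 1 \ {a})
        (Y' := availB (splitEconomy X Y) (toMatching (solA X Y) (solB X Y)) 1)
        (fun x hx => path_zero_eq_none_of_mem_availA (Finset.sdiff_subset hx))
        (fun y hy => path_zero_eq_none_of_mem_availB hy)
      have hfa : f' a = none := hf' a (by simp) hn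
      refine ⟨toMatching f' g', ⟨⟨hm, hagree, fun s _ => by simp [toMatching, hfa, path]⟩, ?_⟩, ?_⟩
      · rw [hRE.1 _ rfl]
        exact hstable _ rfl rfl rfl
      · rw [Upay_toMatching_one, Upay_toMatching_one, hfa]
        exact valA_le hP a (hA1 a)
    · have hn := path_zero_eq_none_of_mem_availB hb
      obtain ⟨f', g', hm, hagree, -, hg', hstable⟩ := exists_replanned hP hC
        (X' := availA (splitEconomy X Y) (toMatching (solA X Y) (solB X Y)) 1)
        (Y' := availB (splitEconomy X Y) (toMatching (solA X Y) (solB X Y)) 1 \ {b})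
        (fun x hx => path_zero_eq_none_of_mem_availA hx)
        (fun y hy => path_zero_eq_none_of_mem_availB (Finset.sdiff_subset hy))
      have hgb : g' b = none := hg' b (by simp) hn
      refine ⟨toMatching f' g', ⟨⟨hm, hagree, fun s _ => by simp [toMatching, hgb, path]⟩, ?_⟩, ?_⟩
      · rw [hRE.1 _ rfl]
        exact hstable _ rfl rfl rfl
      · rw [Vpay_toMatching_one, Vpay_toMatching_one, hgb]
        exact valB_le hP b (hB1 b)
    · rw [Upay_toMatching_one, Vpay_toMatching_one] at hlt
      rcases hblock1 a b (path_zero_eq_none_of_mem_availA ha)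
        (path_zero_eq_none_of_mem_availB hb) with h | h
      · exact not_lt.2 (valA_le hP a h) hlt.1
      · exact not_lt.2 (valB_le hP b h) hlt.2
termination_by X.card + Y.card
decreasing_by
  · have := Finset.card_erase_lt_of_mem ha
    rw [Finset.sdiff_singleton_eq_erase]
    omega
  · have := Finset.card_erase_lt_of_mem hb
    rw [Finset.sdiff_singleton_eq_erase]
    omega

/-- in the Example-1 economy, `m*` is a rational expectations solution. -/
theorem statement14 (P : Pref (Fin 4) (Fin 4)) (hP : Ex1Pref P)
    (RE : Economy (Fin 4) (Fin 4) → Set (PreMatching (Fin 4) (Fin 4)))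
    (hRE : IsREFamily P RE) :
    mstar1 ∈ RE E1 := by
  have hE : E1 = splitEconomy {0, 1, 2} {0, 1} := by
    refine congrArg₂ (Economy.mk 2) ?_ ?_ <;> funext s <;>
      by_cases h0 : s = 0 <;> by_cases h1 : s = 1 <;> simp [h0, h1] <;> decide
  have hm : mstar1 = toMatching (solA {0, 1, 2} {0, 1}) (solB {0, 1, 2} {0, 1}) := by
    refine congrArg₂ PreMatching.mk ?_ ?_ <;> funext t k <;> by_cases h0 : t = 0 <;>
      simp only [h0, if_true, if_false] <;> fin_cases k <;>
      simp [solA, solB, sol, path, h0]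
  rw [hE, hm]
  exact sol_mem_RE hP hRE _ _ (by decide) (by decide)

end

end DynMatch
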